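/- Let k ≥ 2 be a fixed integer, let q be a prime power, and suppose q^{2k} − 1 = ab where a and b are coprime positive integers. Then there exists a set X ⊆ ℤ² that is doubly periodic with periods a and b (i.e. (x,y) ∈ X if and only if (x+a, y) ∈ X, if and only if (x, y+b) ∈ X) such that for every (x₀,y₀) ∈ ℤ², the intersection of X with the rectangle {x₀, x₀+1, …, x₀+a−1} × {y₀, y₀+1, …, y₀+b−1} consists of exactly q points which form a B₂ₖ sequence over ℤ² — in particular, this intersection is a DD(q) with maximal k-hop coverage. -/

import Mathlib

/-- All differences of distinct pairs of points of `D` are pairwise distinct. -/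
def HasDistinctDifferences {G : Type*} [AddCommGroup G] (D : Set G) : Prop :=
  ∀ v ∈ D, ∀ w ∈ D, ∀ v' ∈ D, ∀ w' ∈ D,
    v ≠ w → v' ≠ w' → v - w = v' - w' → v = v' ∧ w = w'

/-- The set of nonzero elements expressible as a sum of at most `k` difference
vectors of `D`. -/
def khopSet {G : Type*} [AddCommGroup G] (D : Set G) (k : ℕ) : Set G :=
  {x | x ≠ 0 ∧ ∃ ℓ : ℕ, ℓ ≤ k ∧ ∃ a b : Fin ℓ → G,
    (∀ i, a i ∈ D ∧ b i ∈ D ∧ a i ≠ b i) ∧ x = ∑ i, (a i - b i)}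

/-- `Ck D k` is the `k`-hop coverage of `D`. -/
noncomputable def Ck {G : Type*} [AddCommGroup G] (D : Set G) (k : ℕ) : ℕ :=
  (khopSet D k).ncard

/-- `H m k` is the set of m-tuples of integers summing to 0 whose positive
entries sum to `k`. -/
def H (m k : ℕ) : Set (Fin m → ℤ) :=
  {a | ∑ i, a i = 0 ∧ ∑ i ∈ Finset.univ.filter (fun i => 0 < a i), a i = (k : ℤ)}

/-- `v₁, …, v_m` is a `B_h` sequence: all sums of `h` of the `v_i` (with
repetition allowed, i.e. indexed by multisets of indices of size `h`) are
distinct. -/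
def IsBhSeq {G : Type*} [AddCommGroup G] {m : ℕ} (h : ℕ) (v : Fin m → G) : Prop :=
  ∀ s t : Multiset (Fin m), Multiset.card s = h → Multiset.card t = h →
    (s.map v).sum = (t.map v).sum → s = t

open Polynomial in
/-- For `θ` of degree `h`, a product of `h` factors `θ - c` determines the multiset of the `c`. -/
theorem multiset_eq_of_prod_sub_algebraMap_eq {K L : Type*} [Field K] [Field L] [Algebra K L]
    {θ : L} {s t : Multiset K} (hs : s.card = (minpoly K θ).natDegree)
    (ht : t.card = (minpoly K θ).natDegree)
    (h : (s.map fun c => θ - algebraMap K L c).prod = (t.map fun c => θ - algebraMap K L c).prod) :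
    s = t := by
  have aeval_prod (u : Multiset K) :
      aeval θ (u.map fun c => X - C c).prod = (u.map fun c => θ - algebraMap K L c).prod := by
    rw [map_multiset_prod, Multiset.map_map]
    congr 1
    exact Multiset.map_congr rfl fun c _ => by simp
  have monic_prod (u : Multiset K) : (u.map fun c => X - C c).prod.Monic :=
    monic_multiset_prod_of_monic _ _ fun c _ => monic_X_sub_C c
  have degree_prod (u : Multiset K) : (u.map fun c => X - C c).prod.degree = (u.card : WithBot ℕ) := by
    rw [degree_eq_natDegree (monic_prod u).ne_zero, natDegree_multiset_prod_X_sub_C_eq_card]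
  have heq : (s.map fun c => X - C c).prod = (t.map fun c => X - C c).prod := by
    by_contra hne
    have hle := minpoly.degree_le_of_ne_zero K θ (sub_ne_zero.2 hne)
      (by rw [map_sub, aeval_prod, aeval_prod, h, sub_self])
    have hlt := degree_sub_lt_left (p := (s.map fun c => X - C c).prod)
      (q := (t.map fun c => X - C c).prod) (by rw [degree_prod, degree_prod, hs, ht])
      (monic_prod s).ne_zero
      (by rw [(monic_prod s).leadingCoeff, (monic_prod t).leadingCoeff])
    rw [degree_prod, hs, ← natDegree_lt_iff_degree_lt (sub_ne_zero.2 hne)] at hlt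
    exact (natDegree_le_natDegree hle).not_gt hlt
  simpa only [roots_multiset_prod_X_sub_C] using congrArg roots heq

/-- The Bose–Chowla theorem: for a prime power `q` there is a `B_h` sequence of length `q` over
`ZMod (q ^ h - 1)`. -/
theorem exists_bhSeq_zmod {q h : ℕ} (hq : IsPrimePow q) (hh : 2 ≤ h) :
    ∃ e : Fin q → ℤ, IsBhSeq h fun i => (e i : ZMod (q ^ h - 1)) := by
  obtain ⟨p, n, hp, hn, rfl⟩ := hq
  have := Fact.mk hp.nat_prime
  have : NeZero h := ⟨by omega⟩
  let K := GaloisField p n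
  let L := FiniteField.Extension K p h
  have cardK : Nat.card K = p ^ n := GaloisField.card p n hn.ne'
  have cardL : Nat.card L = (p ^ n) ^ h := by rw [FiniteField.natCard_extension, cardK]
  obtain ⟨θ, hθ⟩ := Field.exists_primitive_element K L
  have hdeg : (minpoly K θ).natDegree = h := by
    rw [(Field.primitive_element_iff_minpoly_natDegree_eq K θ).1 hθ,
      FiniteField.finrank_extension]
  have hne (c : K) : θ - algebraMap K L c ≠ 0 := by
    intro h0
    rw [sub_eq_zero.1 h0, minpoly.eq_X_sub_C, Polynomial.natDegree_X_sub_C] at hdeg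
    omega
  obtain ⟨g, hg⟩ := exists_zpow_surjective Lˣ
  choose e he using fun c : K => hg (Units.mk0 _ (hne c))
  have hord : orderOf g = (p ^ n) ^ h - 1 := by
    rw [orderOf_eq_card_of_forall_mem_zpowers fun x => hg x, Nat.card_units, cardL]
  let σ : Fin (p ^ n) ≃ K := (Finite.equivFinOfCardEq cardK).symm
  refine ⟨fun i => e (σ i), fun s t hs ht hst => ?_⟩
  have zpow_sum (u : Multiset (Fin (p ^ n))) :
      ((g ^ (u.map fun i => e (σ i)).sum : Lˣ) : L)
        = ((u.map σ).map fun c => θ - algebraMap K L c).prod := by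
    induction u using Multiset.induction_on with
    | empty => simp
    | cons i u ih =>
      have hi := congrArg Units.val (he (σ i))
      simp only [Units.val_mk0] at hi
      simp only [Multiset.map_cons, Multiset.sum_cons, Multiset.prod_cons, zpow_add,
        Units.val_mul, ih, ← hi]
  have cast_sum (u : Multiset (Fin (p ^ n))) :
      (u.map fun i => (e (σ i) : ZMod ((p ^ n) ^ h - 1))).sum
        = ((u.map fun i => e (σ i)).sum : ℤ) := by
    have := map_multiset_sum (Int.castAddHom (ZMod ((p ^ n) ^ h - 1))) (u.map fun i => e (σ i))
    rw [Multiset.map_map] at this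
    exact this.symm
  rw [cast_sum, cast_sum, ZMod.intCast_eq_intCast_iff, ← hord, ← zpow_eq_zpow_iff_modEq] at hst
  have hprod := congrArg Units.val hst
  rw [zpow_sum, zpow_sum] at hprod
  exact Multiset.map_injective σ.injective (multiset_eq_of_prod_sub_algebraMap_eq
    (by rw [Multiset.card_map, hs, hdeg]) (by rw [Multiset.card_map, ht, hdeg]) hprod)

namespace IsBhSeq

variable {G : Type*} [AddCommGroup G] {m h k : ℕ} {v : Fin m → G}

theorem of_comp {G' : Type*} [AddCommGroup G'] (f : G →+ G') (hv : IsBhSeq h (f ∘ v)) :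
    IsBhSeq h v := fun s t hs ht hst =>
  hv s t hs ht <| by simpa only [map_multiset_sum, Multiset.map_map] using congrArg f hst

theorem mono (hv : IsBhSeq h v) (hkh : k ≤ h) : IsBhSeq k v := by
  intro s t hs ht hst
  rcases isEmpty_or_nonempty (Fin m) with _ | ⟨⟨i⟩⟩
  · exact Subsingleton.elim s t
  · refine add_right_cancel (b := Multiset.replicate (h - k) i) (hv _ _ ?_ ?_ ?_)
    · rw [Multiset.card_add, hs, Multiset.card_replicate]; omega
    · rw [Multiset.card_add, ht, Multiset.card_replicate]; omega
    · simp only [Multiset.map_add, Multiset.sum_add, hst]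

theorem injective (hv : IsBhSeq h v) (hh : 1 ≤ h) : Function.Injective v := fun i j hij => by
  simpa using hv.mono hh {i} {j} rfl rfl (by simpa using hij)

theorem hasDistinctDifferences (hv : IsBhSeq h v) (hh : 2 ≤ h) :
    HasDistinctDifferences (Set.range v) := by
  rintro _ ⟨i, rfl⟩ _ ⟨j, rfl⟩ _ ⟨i', rfl⟩ _ ⟨j', rfl⟩ hij hij' heq
  have hst : ({i, j'} : Multiset (Fin m)) = {i', j} := by
    refine hv.mono hh _ _ rfl rfl ?_
    simpa using sub_eq_sub_iff_add_eq_add.1 heq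
  have hi : i ∈ ({i', j} : Multiset (Fin m)) := hst ▸ by simp
  have hj : j ∈ ({i, j'} : Multiset (Fin m)) := hst ▸ by simp
  simp only [Multiset.insert_eq_cons, Multiset.mem_cons, Multiset.mem_singleton] at hi hj
  exact ⟨by grind, by grind⟩

end IsBhSeq

/-- The sum of the positive entries of an integer tuple. -/
def posSum {m : ℕ} (c : Fin m → ℤ) : ℕ := ∑ i, (c i).toNat

section posSum

variable {m k : ℕ}

theorem posSum_add_le (c d : Fin m → ℤ) : posSum (c + d) ≤ posSum c + posSum d := by
  rw [posSum, posSum, posSum, ← Finset.sum_add_distrib]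
  exact Finset.sum_le_sum fun i _ => by simp only [Pi.add_apply]; omega

theorem posSum_sub_posSum_neg (c : Fin m → ℤ) : (posSum c : ℤ) - posSum (-c) = ∑ i, c i := by
  rw [posSum, posSum, Nat.cast_sum, Nat.cast_sum, ← Finset.sum_sub_distrib]
  exact Finset.sum_congr rfl fun i _ => by simp only [Pi.neg_apply]; omega

theorem posSum_neg {c : Fin m → ℤ} (hc : ∑ i, c i = 0) : posSum (-c) = posSum c := by
  have := posSum_sub_posSum_neg c
  omega

theorem toNat_le_posSum (c : Fin m → ℤ) (i : Fin m) : (c i).toNat ≤ posSum c :=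
  Finset.single_le_sum (f := fun i => (c i).toNat) (fun _ _ => Nat.zero_le _) (Finset.mem_univ i)

theorem abs_le_posSum {c : Fin m → ℤ} (hc : ∑ i, c i = 0) (i : Fin m) : |c i| ≤ posSum c := by
  have h₁ := toNat_le_posSum c i
  have h₂ := toNat_le_posSum (-c) i
  rw [posSum_neg hc, Pi.neg_apply] at h₂
  rw [abs_le]
  omega

theorem eq_zero_of_posSum_eq_zero {c : Fin m → ℤ} (hc : ∑ i, c i = 0) (h : posSum c = 0) :
    c = 0 := by
  ext i
  simpa [h] using abs_le_posSum hc i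

theorem mem_H_iff {c : Fin m → ℤ} : c ∈ H m k ↔ ∑ i, c i = 0 ∧ posSum c = k := by
  have : ∑ i with 0 < c i, c i = posSum c := by
    rw [posSum, Nat.cast_sum, Finset.sum_filter]
    exact Finset.sum_congr rfl fun i _ => by split_ifs <;> omega
  rw [H, Set.mem_ofPred_eq, this, Nat.cast_inj]

theorem finite_H (m k : ℕ) : (H m k).Finite := by
  refine (Set.finite_Icc (fun _ : Fin m => -(k : ℤ)) fun _ => (k : ℤ)).subset fun c hc => ?_
  obtain ⟨h₀, hk⟩ := mem_H_iff.1 hc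
  have h (i : Fin m) := abs_le.1 (hk ▸ abs_le_posSum h₀ i)
  exact ⟨fun i => (h i).1, fun i => (h i).2⟩

theorem posSum_single_sub_single_le (i j : Fin m) :
    posSum (Pi.single i 1 - Pi.single j 1) ≤ 1 := by
  calc posSum (Pi.single i 1 - Pi.single j 1)
      ≤ ∑ l, if l = i then 1 else 0 := Finset.sum_le_sum fun l _ => by
        simp only [Pi.sub_apply, Pi.single_apply]
        split_ifs <;> simp
    _ = 1 := by simp

theorem posSum_sum_single_sub_single_le {ℓ : ℕ} (α β : Fin ℓ → Fin m) :
    posSum (∑ l, (Pi.single (α l) 1 - Pi.single (β l) 1)) ≤ ℓ := by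
  induction ℓ with
  | zero => simp [posSum]
  | succ ℓ ih =>
    rw [Fin.sum_univ_castSucc]
    exact (posSum_add_le _ _).trans (add_le_add (ih _ _) (posSum_single_sub_single_le _ _))

theorem exists_eq_sum_single_sub_single {n : ℕ} {c : Fin m → ℤ} (hc : ∑ i, c i = 0)
    (hn : posSum c = n) : ∃ α β : Fin n → Fin m, (∀ l, α l ≠ β l) ∧
      c = ∑ l, (Pi.single (α l) 1 - Pi.single (β l) 1) := by
  induction n generalizing c with
  | zero => exact ⟨Fin.elim0, Fin.elim0, fun l => l.elim0, by
      simpa using eq_zero_of_posSum_eq_zero hc hn⟩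
  | succ n ih =>
    have hne : ∃ i ∈ Finset.univ, c i ≠ 0 := by
      by_contra! h
      simp [posSum, h] at hn
    obtain ⟨i, -, hi⟩ := Finset.exists_pos_of_sum_zero_of_exists_nonzero c hc hne
    obtain ⟨j, -, hj⟩ := Finset.exists_pos_of_sum_zero_of_exists_nonzero (-c)
      (by simpa using hc) (by simpa using hne)
    rw [Pi.neg_apply] at hj
    have hij : i ≠ j := by rintro rfl; omega
    set d : Fin m → ℤ := c - (Pi.single i 1 - Pi.single j 1) with hd
    have hd₀ : ∑ l, d l = 0 := by simp [hd, Finset.sum_sub_distrib, hc]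
    have hdn : posSum d = n := by
      have : posSum c = posSum d + ∑ l, if l = i then 1 else 0 := by
        rw [posSum, posSum, ← Finset.sum_add_distrib]
        refine Finset.sum_congr rfl fun l _ => ?_
        simp only [hd, Pi.sub_apply, Pi.single_apply]
        split_ifs <;> grind
      simp at this
      omega
    obtain ⟨α, β, hαβ, hsum⟩ := ih hd₀ hdn
    refine ⟨Fin.cons i α, Fin.cons j β, Fin.cases hij hαβ, ?_⟩
    rw [Fin.sum_univ_succ]
    simp only [Fin.cons_zero, Fin.cons_succ, ← hsum, hd]
    abel

end posSum

section coverage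

variable {G : Type*} [AddCommGroup G] {m k : ℕ} {v : Fin m → G}

theorem linearCombination_single_sub_single (i j : Fin m) :
    Fintype.linearCombination ℤ v (Pi.single i 1 - Pi.single j 1) = v i - v j := by
  simp [map_sub, Fintype.linearCombination_apply_single]

theorem IsBhSeq.eq_zero_of_linearCombination_eq_zero (hv : IsBhSeq k v) {c : Fin m → ℤ}
    (hc : ∑ i, c i = 0) (hck : posSum c ≤ k) (h : Fintype.linearCombination ℤ v c = 0) :
    c = 0 := by
  let M (d : Fin m → ℤ) : Multiset (Fin m) := ∑ i, Multiset.replicate (d i).toNat i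
  have card_M (d : Fin m → ℤ) : (M d).card = posSum d := by simp [M, posSum]
  have count_M (d : Fin m → ℤ) (i : Fin m) : (M d).count i = (d i).toNat := by
    simp [M, Multiset.count_sum', Multiset.count_replicate]
  have sum_M (d : Fin m → ℤ) : ((M d).map v).sum = ∑ i, (d i).toNat • v i := by
    have := map_sum (Multiset.mapAddMonoidHom v) (fun i => Multiset.replicate (d i).toNat i)
      Finset.univ
    simp only [Multiset.coe_mapAddMonoidHom] at this
    simp only [M, this, ← Multiset.coe_sumAddMonoidHom, map_sum]
    simp
  have hM : M c = M (-c) := by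
    refine hv.mono hck _ _ (card_M c) ((card_M _).trans (posSum_neg hc)) ?_
    rw [sum_M, sum_M, ← sub_eq_zero, ← Finset.sum_sub_distrib, ← h,
      Fintype.linearCombination_apply]
    refine Finset.sum_congr rfl fun i _ => ?_
    rw [← natCast_zsmul, ← natCast_zsmul, ← sub_smul, Pi.neg_apply]
    congr 1
    omega
  ext i
  have := congrArg (Multiset.count i) hM
  rw [count_M, count_M, Pi.neg_apply] at this
  simp only [Pi.zero_apply]
  omega

theorem IsBhSeq.injOn_linearCombination (hv : IsBhSeq (2 * k) v) :
    Set.InjOn (Fintype.linearCombination ℤ v) {c | ∑ i, c i = 0 ∧ posSum c ≤ k} := by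
  rintro c ⟨hc, hck⟩ d ⟨hd, hdk⟩ hcd
  refine sub_eq_zero.1 (hv.eq_zero_of_linearCombination_eq_zero ?_ ?_ ?_)
  · simp [Finset.sum_sub_distrib, hc, hd]
  · have := posSum_add_le c (-d)
    rw [posSum_neg hd, ← sub_eq_add_neg] at this
    omega
  · rw [map_sub, hcd, sub_self]

theorem mem_biUnion_H {c : Fin m → ℤ} :
    c ∈ ⋃ i ∈ Finset.Icc 1 k, H m i ↔ ∑ i, c i = 0 ∧ 1 ≤ posSum c ∧ posSum c ≤ k := by
  simp only [Set.mem_iUnion, mem_H_iff, Finset.mem_Icc, exists_prop]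
  grind

theorem IsBhSeq.khopSet_eq_image (hv : IsBhSeq (2 * k) v) :
    khopSet (Set.range v) k
      = Fintype.linearCombination ℤ v '' ⋃ i ∈ Finset.Icc 1 k, H m i := by
  ext x
  simp only [Set.mem_image, mem_biUnion_H]
  constructor
  · rintro ⟨hx, ℓ, hℓ, a, b, hab, rfl⟩
    choose α hα using fun l => (hab l).1
    choose β hβ using fun l => (hab l).2.1
    have hΦ : Fintype.linearCombination ℤ v (∑ l, (Pi.single (α l) 1 - Pi.single (β l) 1))
        = ∑ l, (a l - b l) := by
      simp only [map_sum, linearCombination_single_sub_single, hα, hβ]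
    have h₀ : ∑ i, (∑ l, (Pi.single (α l) 1 - Pi.single (β l) 1) : Fin m → ℤ) i = 0 := by
      simp only [Finset.sum_apply]
      rw [Finset.sum_comm]
      simp [Finset.sum_sub_distrib]
    refine ⟨_, ⟨h₀, Nat.one_le_iff_ne_zero.2 fun h => hx ?_,
      (posSum_sum_single_sub_single_le α β).trans hℓ⟩, hΦ⟩
    rw [← hΦ, eq_zero_of_posSum_eq_zero h₀ h, map_zero]
  · rintro ⟨c, ⟨h₀, h₁, hk⟩, rfl⟩
    refine ⟨fun h => ?_, posSum c, hk, ?_⟩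
    · have := hv.eq_zero_of_linearCombination_eq_zero h₀ (by omega) h
      simp [posSum, this] at h₁
    · obtain ⟨α, β, hαβ, hc⟩ := exists_eq_sum_single_sub_single h₀ rfl
      refine ⟨v ∘ α, v ∘ β, fun l => ⟨⟨_, rfl⟩, ⟨_, rfl⟩, fun h => hαβ l ?_⟩, ?_⟩
      · exact hv.injective (by omega) h
      · conv_lhs => rw [hc]
        simp only [map_sum, linearCombination_single_sub_single, Function.comp_apply]

theorem IsBhSeq.Ck_eq_sum_ncard_H (hv : IsBhSeq (2 * k) v) :
    Ck (Set.range v) k = ∑ i ∈ Finset.Icc 1 k, (H m i).ncard := by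
  rw [Ck, hv.khopSet_eq_image, Set.InjOn.ncard_image]
  · have hcard := (Finset.Icc 1 k).finite_toSet.ncard_biUnion (s := H m)
      (fun i _ => finite_H m i) fun i _ j _ hij => Set.disjoint_left.2 fun c hi hj =>
        hij ((mem_H_iff.1 hi).2.symm.trans (mem_H_iff.1 hj).2)
    rwa [finsum_mem_coe_finset] at hcard
  · exact hv.injOn_linearCombination.mono fun c hc =>
      And.imp_right And.right (mem_biUnion_H.1 hc)

end coverage

/-- Chinese remaindering: the points of an `a × b` rectangle represent each residue class
modulo `a * b` exactly once under `(x, y) ↦ b * x + a * y`. -/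
theorem existsUnique_rectangle_dvd {a b : ℕ} (ha : 0 < a) (hb : 0 < b) (hab : a.Coprime b)
    (x₀ y₀ N : ℤ) : ∃! p : ℤ × ℤ, (x₀ ≤ p.1 ∧ p.1 < x₀ + a ∧ y₀ ≤ p.2 ∧ p.2 < y₀ + b) ∧
      ((a * b : ℕ) : ℤ) ∣ b * p.1 + a * p.2 - N := by
  have hco : IsCoprime (a : ℤ) b := Nat.isCoprime_iff_coprime.2 hab
  have ha' : (0 : ℤ) < a := by exact_mod_cast ha
  have hb' : (0 : ℤ) < b := by exact_mod_cast hb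
  push_cast
  obtain ⟨u, w, huw⟩ := id hco
  refine ⟨(x₀ + (N * w - x₀) % a, y₀ + (N * u - y₀) % b), ⟨⟨?_, ?_, ?_, ?_⟩, ?_⟩, ?_⟩
  · have := Int.emod_nonneg (N * w - x₀) ha'.ne'
    simpa
  · have := Int.emod_lt_of_pos (N * w - x₀) ha'
    simpa
  · have := Int.emod_nonneg (N * u - y₀) hb'.ne'
    simpa
  · have := Int.emod_lt_of_pos (N * u - y₀) hb'
    simpa
  · refine ⟨-((N * w - x₀) / a) - (N * u - y₀) / b, ?_⟩
    simp only [Int.emod_def]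
    linear_combination N * huw
  · have key {x y : ℤ} (h : (a * b : ℤ) ∣ b * x + a * y) : (a : ℤ) ∣ x ∧ (b : ℤ) ∣ y :=
      ⟨hco.dvd_of_dvd_mul_left ((Int.dvd_add_left (dvd_mul_right _ _)).1
          ((dvd_mul_right _ _).trans h)),
        hco.symm.dvd_of_dvd_mul_left ((Int.dvd_add_right (dvd_mul_right _ _)).1
          ((dvd_mul_left _ _).trans h))⟩
    rintro ⟨x, y⟩ ⟨⟨hx₁, hx₂, hy₁, hy₂⟩, hdvd⟩
    dsimp only at hx₁ hx₂ hy₁ hy₂ hdvd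
    obtain ⟨hdx, hdy⟩ := key (x := x - N * w) (y := y - N * u) (by
      convert hdvd using 1
      linear_combination -N * huw)
    have hx : (x - x₀) % a = (N * w - x₀) % a :=
      Int.emod_eq_emod_iff_emod_sub_eq_zero.2 (Int.emod_eq_zero_of_dvd (by simpa using hdx))
    have hy : (y - y₀) % b = (N * u - y₀) % b :=
      Int.emod_eq_emod_iff_emod_sub_eq_zero.2 (Int.emod_eq_zero_of_dvd (by simpa using hdy))
    rw [Int.emod_eq_of_lt (by omega) (by omega)] at hx hy
    ext <;> simp only [← hx, ← hy] <;> ring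


theorem stmt11 (k q a b : ℕ) (hk : 2 ≤ k) (hq : IsPrimePow q)
    (ha : 0 < a) (hb : 0 < b) (hab : Nat.Coprime a b)
    (hprod : a * b = q ^ (2 * k) - 1) :
    ∃ X : Set (ℤ × ℤ),
      (∀ x y : ℤ, (x, y) ∈ X ↔ (x + (a : ℤ), y) ∈ X) ∧
      (∀ x y : ℤ, (x, y) ∈ X ↔ (x, y + (b : ℤ)) ∈ X) ∧
      ∀ x₀ y₀ : ℤ, ∃ v : Fin q → ℤ × ℤ,
        Function.Injective v ∧
        Set.range v =
          X ∩ {p : ℤ × ℤ | x₀ ≤ p.1 ∧ p.1 < x₀ + a ∧ y₀ ≤ p.2 ∧ p.2 < y₀ + b} ∧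
        IsBhSeq (2 * k) v ∧
        HasDistinctDifferences (Set.range v) ∧
        Ck (Set.range v) k = ∑ i ∈ Finset.Icc 1 k, (H q i).ncard := by
  have hh : 2 ≤ 2 * k := by omega
  obtain ⟨e, he⟩ := exists_bhSeq_zmod hq hh
  rw [← hprod] at he
  let f : ℤ × ℤ →+ ZMod (a * b) := (Int.castAddHom _).comp
    ((AddMonoidHom.mulLeft (b : ℤ)).coprod (AddMonoidHom.mulLeft (a : ℤ)))
  have f_apply (p : ℤ × ℤ) : f p = ((b * p.1 + a * p.2 : ℤ) : ZMod (a * b)) := rfl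
  have f_add_a (x y : ℤ) : f (x + a, y) = f (x, y) := by
    rw [f_apply, f_apply, ZMod.intCast_eq_intCast_iff_dvd_sub]
    exact ⟨-1, by push_cast; ring⟩
  have f_add_b (x y : ℤ) : f (x, y + b) = f (x, y) := by
    rw [f_apply, f_apply, ZMod.intCast_eq_intCast_iff_dvd_sub]
    exact ⟨-1, by push_cast; ring⟩
  refine ⟨{p | ∃ i, f p = e i}, fun x y => ?_, fun x y => ?_, fun x₀ y₀ => ?_⟩
  · simp only [Set.mem_ofPred_eq, f_add_a]
  · simp only [Set.mem_ofPred_eq, f_add_b]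
  have hrect (i : Fin q) : ∃! p : ℤ × ℤ,
      (x₀ ≤ p.1 ∧ p.1 < x₀ + a ∧ y₀ ≤ p.2 ∧ p.2 < y₀ + b) ∧ f p = e i := by
    have hiff (p : ℤ × ℤ) : f p = e i ↔ ((a * b : ℕ) : ℤ) ∣ b * p.1 + a * p.2 - e i := by
      rw [eq_comm, f_apply, ZMod.intCast_eq_intCast_iff_dvd_sub]
    simpa only [hiff] using existsUnique_rectangle_dvd ha hb hab x₀ y₀ (e i)
  choose v hv huniq using hrect
  have hbh : IsBhSeq (2 * k) v := .of_comp f (by convert he using 2; exact (hv _).2)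
  refine ⟨v, hbh.injective (by omega), ?_, hbh, hbh.hasDistinctDifferences hh,
    hbh.Ck_eq_sum_ncard_H⟩
  ext p
  constructor
  · rintro ⟨i, rfl⟩
    exact ⟨⟨i, (hv i).2⟩, (hv i).1⟩
  · rintro ⟨⟨i, hi⟩, hp⟩
    exact ⟨i, (huniq i p ⟨hp, hi⟩).symm⟩
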